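/- The number of permutations p of {1,...,n} (n ≥ 2) avoiding circular 1-successions, where the forbidden adjacent pairs are only j(j+1) for 1 ≤ j ≤ n-1 (no wraparound pair n1 in the values, but adjacency is cyclic in positions including p(n),p(1)), equals n · D_{n-1}, where D_{n-1} is the (n-1)st derangement number. -/

import Mathlib

open Equiv Equiv.Perm in
/-- A permutation of a finite type is a single cycle on the whole type iff it has no nontrivial
invariant set. -/
theorem isCycleOn_univ_iff_forall_mapsTo {α : Type*} [Finite α] (σ : Perm α) :
    σ.IsCycleOn Set.univ ↔
      ∀ s : Set α, s.Nonempty → (∀ a ∈ s, σ a ∈ s) → ∀ b, b ∈ s := by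
  constructor
  · rintro ⟨-, h⟩ s ⟨a, ha⟩ hs b
    obtain ⟨k, -, hk⟩ := (h (Set.mem_univ a) (Set.mem_univ b)).exists_pow_eq'
    have hpow : ∀ k : ℕ, (σ ^ k) a ∈ s := by
      intro k
      induction k with
      | zero => simpa using ha
      | succ k ih => rw [pow_succ', Perm.mul_apply]; exact hs _ ih
    exact hk ▸ hpow k
  · intro h
    refine ⟨σ.bijective.bijOn_univ, fun a _ b _ => ?_⟩
    exact h {b | SameCycle σ a b} ⟨a, SameCycle.refl _ _⟩
      (fun c hc => sameCycle_apply_right.2 hc) b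

open Equiv Equiv.Perm in
theorem decomposeFin_symm_apply_succ_eq_succ_iff {n : ℕ} (p : Fin (n + 1)) (σ : Perm (Fin n))
    (x y : Fin n) :
    decomposeFin.symm (p, σ) x.succ = y.succ ↔ σ x = y ∧ p ≠ y.succ := by
  rw [decomposeFin_symm_apply_succ, swap_apply_def]
  have h0 := Fin.succ_ne_zero (σ x)
  have h1 := Fin.succ_ne_zero y
  split_ifs with h <;> grind [Fin.succ_inj]

open Equiv Equiv.Perm in
theorem isCycleOn_univ_decomposeFin_symm_succ_iff {n : ℕ} (p : Fin n) (σ : Perm (Fin n)) :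
    (decomposeFin.symm (p.succ, σ)).IsCycleOn Set.univ ↔ σ.IsCycleOn Set.univ := by
  have hzero : decomposeFin.symm (p.succ, σ) 0 = p.succ := decomposeFin_symm_apply_zero _ _
  have hsucc : ∀ x, decomposeFin.symm (p.succ, σ) x.succ = if σ x = p then 0 else (σ x).succ := by
    intro x
    rw [decomposeFin_symm_apply_succ, swap_apply_def]
    simp [Fin.succ_ne_zero]
  rw [isCycleOn_univ_iff_forall_mapsTo, isCycleOn_univ_iff_forall_mapsTo]
  generalize decomposeFin.symm (p.succ, σ) = τ at hzero hsucc
  constructor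
  · rintro h s ⟨a, ha⟩ hs b
    have hb := h {c | (∃ x ∈ s, c = x.succ) ∨ c = 0 ∧ p ∈ s} ⟨a.succ, .inl ⟨a, ha, rfl⟩⟩ (by
      rintro c (⟨x, hx, rfl⟩ | ⟨rfl, hp⟩)
      · have := hs x hx
        rw [hsucc]
        split_ifs with hxp
        · exact .inr ⟨rfl, hxp ▸ this⟩
        · exact .inl ⟨_, this, rfl⟩
      · exact .inl ⟨p, hp, hzero⟩) b.succ
    simpa [Fin.succ_ne_zero] using hb
  · rintro h s ⟨a, ha⟩ hs
    have key : ∀ x : Fin n, x.succ ∈ s := by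
      apply h {x | x.succ ∈ s}
      · induction a using Fin.cases with
        | zero => exact ⟨p, by have := hs _ ha; rwa [hzero] at this⟩
        | succ x => exact ⟨x, ha⟩
      · intro x hx
        have hx' := hs _ hx
        rw [hsucc] at hx'
        split_ifs at hx' with hxp
        · have := hs _ hx'
          rwa [hzero, ← hxp] at this
        · exact hx'
    intro b
    induction b using Fin.cases with
    | zero =>
      have := hs _ (key (σ.symm p))
      rwa [hsucc, Equiv.apply_symm_apply, if_pos rfl] at this
    | succ x => exact key x

open Equiv Equiv.Perm in
/-- Inserting a new smallest element before an old one identifies the cyclic orders of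
`Fin (n + 2)` with pairs of an old element and a cyclic order of `Fin (n + 1)`. -/
noncomputable def fullCycleInsertEquiv (n : ℕ) :
    Fin (n + 1) × {σ : Perm (Fin (n + 1)) // σ.IsCycleOn Set.univ} ≃
      {τ : Perm (Fin (n + 2)) // τ.IsCycleOn Set.univ} :=
  Equiv.ofBijective
    (fun x => ⟨decomposeFin.symm (x.1.succ, x.2.1),
      (isCycleOn_univ_decomposeFin_symm_succ_iff _ _).2 x.2.2⟩) <| by
    constructor
    · rintro ⟨p, σ, hσ⟩ ⟨q, ρ, hρ⟩ h
      have := decomposeFin.symm.injective (congrArg Subtype.val h)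
      simpa using this
    · rintro ⟨τ, hτ⟩
      obtain ⟨⟨q, σ⟩, rfl⟩ := decomposeFin.symm.surjective τ
      induction q using Fin.cases with
      | zero =>
        have := (isCycleOn_univ_iff_forall_mapsTo _).1 hτ {0} ⟨0, rfl⟩
          (by simp [decomposeFin_symm_apply_zero]) 1
        simp at this
      | succ p =>
        exact ⟨(p, ⟨σ, (isCycleOn_univ_decomposeFin_symm_succ_iff p σ).1 hτ⟩), rfl⟩

open Equiv Equiv.Perm in
/-- Permutations of `Fin n` correspond to cyclic orders of `Fin (n + 1)`, with fixed points
turned into successions. -/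
theorem exists_equiv_fullCycle_fixedPoint_iff_succession (n : ℕ) :
    ∃ Φ : Perm (Fin n) ≃ {σ : Perm (Fin (n + 1)) // σ.IsCycleOn Set.univ},
      ∀ π j, π j = j ↔ (Φ π).1 j.castSucc = j.succ := by
  induction n with
  | zero =>
    have : Nonempty {σ : Perm (Fin (0 + 1)) // σ.IsCycleOn Set.univ} :=
      ⟨1, (isCycleOn_univ_iff_forall_mapsTo _).2 fun s ⟨a, ha⟩ _ b => Subsingleton.elim (α := Fin 1) a b ▸ ha⟩
    have : Unique {σ : Perm (Fin (0 + 1)) // σ.IsCycleOn Set.univ} :=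
      ⟨⟨this.some⟩, fun _ => Subtype.ext (Subsingleton.elim (α := Perm (Fin 1)) _ _)⟩
    exact ⟨Equiv.ofUnique _ _, fun _ j => j.elim0⟩
  | succ n ih =>
    obtain ⟨Φ, hΦ⟩ := ih
    refine ⟨decomposeFin.trans (((Equiv.refl _).prodCongr Φ).trans (fullCycleInsertEquiv n)), ?_⟩
    intro π j
    obtain ⟨⟨p, π⟩, rfl⟩ := decomposeFin.symm.surjective π
    change _ ↔ decomposeFin.symm ((decomposeFin (decomposeFin.symm (p, π))).1.succ,
      (Φ (decomposeFin (decomposeFin.symm (p, π))).2).1) _ = _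
    rw [Equiv.apply_symm_apply]
    induction j using Fin.cases with
    | zero =>
      rw [Fin.castSucc_zero, decomposeFin_symm_apply_zero, decomposeFin_symm_apply_zero,
        Fin.succ_inj]
    | succ i =>
      rw [Fin.castSucc_succ, decomposeFin_symm_apply_succ_eq_succ_iff,
        decomposeFin_symm_apply_succ_eq_succ_iff, hΦ]
      simp

open Equiv Equiv.Perm in
theorem isCycleOn_univ_finRotate (n : ℕ) : (finRotate (n + 2)).IsCycleOn Set.univ := by
  have h := (isCycle_finRotate (n := n)).isCycleOn
  rwa [← coe_support_eq_set_support, support_finRotate, Finset.coe_univ] at h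

open Equiv Equiv.Perm in
/-- A permutation, read as a circular word, amounts to its first letter and the cyclic order
of its letters. -/
noncomputable def permEquivFirstFullCycle (n : ℕ) :
    Perm (Fin (n + 2)) ≃
      Fin (n + 2) × {σ : Perm (Fin (n + 2)) // σ.IsCycleOn Set.univ} :=
  Equiv.ofBijective
    (fun p => (p 0, ⟨p * finRotate (n + 2) * p⁻¹, by
      simpa using (isCycleOn_univ_finRotate n).conj (g := p)⟩)) <| by
    constructor
    · intro p q h
      simp only [Prod.mk.injEq, Subtype.mk.injEq] at h
      obtain ⟨h0, h⟩ := h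
      ext1 i
      refine (isCycleOn_univ_iff_forall_mapsTo _).1 (isCycleOn_univ_finRotate n)
        {i | p i = q i} ⟨0, h0⟩ (fun i hi => ?_) i
      have hi : p i = q i := hi
      have hrot := DFunLike.congr_fun h (p i)
      have hq : p⁻¹ (p i) = i ∧ q⁻¹ (p i) = i := ⟨p.symm_apply_apply i, by simp [hi]⟩
      rwa [Perm.mul_apply, Perm.mul_apply, Perm.mul_apply, Perm.mul_apply, hq.1, hq.2] at hrot
    · rintro ⟨b, σ, hσ⟩
      have hcyc : IsCycle σ := by
        rw [isCycle_iff_exists_isCycleOn]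
        exact ⟨_, Set.nontrivial_univ, hσ, fun _ _ => Set.mem_univ _⟩
      have hsupp : σ.support = Finset.univ := by
        ext x
        simpa using hσ.apply_ne Set.nontrivial_univ (Set.mem_univ x)
      obtain ⟨c, hc⟩ := isConj_iff.1 ((isCycle_finRotate (n := n)).isConj hcyc
        (by rw [support_finRotate, hsupp]))
      obtain ⟨k, hk⟩ := (isCycleOn_univ_finRotate n).2 (Set.mem_univ 0) (Set.mem_univ (c⁻¹ b))
      refine ⟨c * finRotate (n + 2) ^ k, Prod.ext ?_ (Subtype.ext ?_)⟩
      · simp [hk]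
      · change c * finRotate (n + 2) ^ k * finRotate (n + 2) * (c * finRotate (n + 2) ^ k)⁻¹ = σ
        rw [← hc]
        group

/-- For `n ≥ 2`, the number of permutations of `{1,...,n}` avoiding circular
1-successions (forbidden value pairs `j(j+1)`, `1 ≤ j ≤ n-1`, no wraparound in values,
but cyclic adjacency of positions) equals `n` times the `(n-1)`-st derangement number. -/
theorem dstar_one_eq_n_mul_derangements (n : ℕ) (hn : 2 ≤ n) :
    Nat.card {p : Equiv.Perm (Fin n) //
        ∀ i : Fin n, ((p (finRotate n i)) : ℕ) ≠ (p i : ℕ) + 1} =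
      n * numDerangements (n - 1) := by
  obtain ⟨m, rfl⟩ := Nat.exists_eq_add_of_le' hn
  obtain ⟨Φ, hΦ⟩ := exists_equiv_fullCycle_fixedPoint_iff_succession (m + 1)
  let e : Equiv.Perm (Fin (m + 2)) ≃ Equiv.Perm (Fin (m + 1)) × Fin (m + 2) :=
    (permEquivFirstFullCycle m).trans (((Equiv.refl _).prodCongr Φ.symm).trans (Equiv.prodComm _ _))
  have he : ∀ p, (∀ i, (p (finRotate (m + 2) i) : ℕ) ≠ (p i : ℕ) + 1) ↔
      (e p).1 ∈ derangements (Fin (m + 1)) := by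
    intro p
    have hσ : (Φ (e p).1).1 = p * finRotate (m + 2) * p⁻¹ :=
      congrArg Subtype.val (Φ.apply_symm_apply (permEquivFirstFullCycle m p).2)
    have hval : (∀ i, (p (finRotate (m + 2) i) : ℕ) ≠ (p i : ℕ) + 1) ↔
        ∀ i : Fin (m + 2), ((Φ (e p).1).1 i : ℕ) ≠ (i : ℕ) + 1 := by
      rw [hσ, p.forall_congr_left]
      simp
    rw [hval, derangements, Set.mem_ofPred_eq]
    simp only [ne_eq, hΦ, Fin.ext_iff, Fin.val_succ]
    refine ⟨fun h j => h j.castSucc, fun h i => ?_⟩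
    induction i using Fin.lastCases with
    | last => exact fun h' => absurd ((Φ (e p).1).1 (Fin.last _)).isLt (by simp [h'])
    | cast j => exact h j
  rw [Nat.card_congr ((e.subtypeEquiv he).trans (Equiv.prodSubtypeFstEquivSubtypeProd
      (p := fun π => π ∈ derangements (Fin (m + 1))))), Nat.card_prod]
  have hcard : Nat.card {π // π ∈ derangements (Fin (m + 1))} = numDerangements (m + 1) := by
    rw [Nat.card_eq_fintype_card]
    exact card_derangements_fin_eq_numDerangements
  rw [hcard, Nat.card_fin, mul_comm]
  rfl
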